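/- Let f : [a,b] → X be strongly Henstock–Kurzweil integrable on [a,b] and assume that for every t₁ ∈ [a₁,b₁] the section f_{t₁} is strongly Henstock–Kurzweil integrable on [a₂,b₂] and for every t₂ ∈ [a₂,b₂] the section f_{t₂} is strongly Henstock–Kurzweil integrable on [a₁,b₁]. Then the function g(t₁) = (HK)∫_{[a₂,b₂]} f_{t₁}, t₁ ∈ [a₁,b₁], is strongly Henstock–Kurzweil integrable on [a₁,b₁] and (HK)∫_{[a₁,b₁]} ((HK)∫_{[a₂,b₂]} f_{t₁}) = (HK)∫_{[a,b]} f. -/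

import Mathlib

open Set MeasureTheory

variable {E : Type*} [MeasureSpace E] [PseudoMetricSpace E] [Preorder E]
variable {X : Type*} [NormedAddCommGroup X] [NormedSpace ℝ X]

/-- The closed interval of a tagged item `(t, p, q)` is `[p, q]` (the tag is `t`). -/
def itemBox (x : E × E × E) : Set E := Set.Icc x.2.1 x.2.2

/-- `[p,q]` is a closed non-degenerate subinterval of `K`. -/
def IsSubinterval (K : Set E) (p q : E) : Prop :=
  Set.Icc p q ⊆ K ∧ (interior (Set.Icc p q)).Nonempty

/-- `P` is an `𝓜`-partition of `K`: a finite collection of tagged pairwise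
non-overlapping closed non-degenerate subintervals of `K` covering `K`, with tags in `K`. -/
def IsMPartition (K : Set E) (P : Finset (E × E × E)) : Prop :=
  (∀ x ∈ P, x.1 ∈ K ∧ IsSubinterval K x.2.1 x.2.2) ∧
  (∀ x ∈ P, ∀ y ∈ P, x ≠ y → interior (itemBox x) ∩ interior (itemBox y) = ∅) ∧
  (⋃ x ∈ P, itemBox x) = K

/-- `𝓗𝓚`-partition: an `𝓜`-partition each of whose tags belongs to its interval. -/
def IsHKPartition (K : Set E) (P : Finset (E × E × E)) : Prop :=
  IsMPartition K P ∧ ∀ x ∈ P, x.1 ∈ itemBox x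

/-- A gauge on `K`: positive on `K`. -/
def IsGauge (K : Set E) (δ : E → ℝ) : Prop := ∀ t ∈ K, 0 < δ t

/-- A tagged partition is `δ`-fine if each interval lies in the open ball
around its tag of radius `δ(tag)`. -/
def IsFine (δ : E → ℝ) (P : Finset (E × E × E)) : Prop :=
  ∀ x ∈ P, itemBox x ⊆ Metric.ball x.1 (δ x.1)

/-- `f` is McShane integrable on `K` with integral `v`. -/
def HasMcShaneIntegral (K : Set E) (f : E → X) (v : X) : Prop :=
  ∀ ε > 0, ∃ δ : E → ℝ, IsGauge K δ ∧
    ∀ P : Finset (E × E × E), IsMPartition K P → IsFine δ P →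
      ‖(∑ x ∈ P, (volume (itemBox x)).toReal • f x.1) - v‖ < ε

/-- `f` is Henstock–Kurzweil integrable on `K` with integral `v`. -/
def HasHKIntegral (K : Set E) (f : E → X) (v : X) : Prop :=
  ∀ ε > 0, ∃ δ : E → ℝ, IsGauge K δ ∧
    ∀ P : Finset (E × E × E), IsHKPartition K P → IsFine δ P →
      ‖(∑ x ∈ P, (volume (itemBox x)).toReal • f x.1) - v‖ < ε

/-- An additive interval function on the non-degenerate closed subintervals of `K`
(an interval is recorded by its pair of corners). -/
def IsAdditiveIntervalFun (K : Set E) (F : E × E → X) : Prop :=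
  ∀ p q r s u w : E, IsSubinterval K p q → IsSubinterval K r s → IsSubinterval K u w →
    interior (Set.Icc p q) ∩ interior (Set.Icc r s) = ∅ →
    Set.Icc p q ∪ Set.Icc r s = Set.Icc u w →
    F (u, w) = F (p, q) + F (r, s)

/-- `f` is strongly McShane integrable on `[a,b]` with `(M)∫_{[a,b]} f = v`. -/
def HasStrongMcShaneIntegral (a b : E) (f : E → X) (v : X) : Prop :=
  ∃ F : E × E → X, IsAdditiveIntervalFun (Set.Icc a b) F ∧ F (a, b) = v ∧
    ∀ ε > 0, ∃ δ : E → ℝ, IsGauge (Set.Icc a b) δ ∧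
      ∀ P : Finset (E × E × E), IsMPartition (Set.Icc a b) P → IsFine δ P →
        ∑ x ∈ P, ‖(volume (itemBox x)).toReal • f x.1 - F (x.2.1, x.2.2)‖ < ε

/-- `f` is strongly Henstock–Kurzweil integrable on `[a,b]` with `(HK)∫_{[a,b]} f = v`. -/
def HasStrongHKIntegral (a b : E) (f : E → X) (v : X) : Prop :=
  ∃ F : E × E → X, IsAdditiveIntervalFun (Set.Icc a b) F ∧ F (a, b) = v ∧
    ∀ ε > 0, ∃ δ : E → ℝ, IsGauge (Set.Icc a b) δ ∧
      ∀ P : Finset (E × E × E), IsHKPartition (Set.Icc a b) P → IsFine δ P →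
        ∑ x ∈ P, ‖(volume (itemBox x)).toReal • f x.1 - F (x.2.1, x.2.2)‖ < ε

/-- Property `𝓢*𝓜` on `[a,b]`. -/
def PropSM (a b : E) (f : E → X) : Prop :=
  ∀ ε > 0, ∃ δ : E → ℝ, IsGauge (Set.Icc a b) δ ∧
    ∀ P Q : Finset (E × E × E),
      IsMPartition (Set.Icc a b) P → IsFine δ P →
      IsMPartition (Set.Icc a b) Q → IsFine δ Q →
      ∑ x ∈ P, ∑ y ∈ Q, ‖f x.1 - f y.1‖ * (volume (itemBox x ∩ itemBox y)).toReal < ε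

/-- Property `𝓢*𝓗𝓚` on `[a,b]`. -/
def PropSHK (a b : E) (f : E → X) : Prop :=
  ∀ ε > 0, ∃ δ : E → ℝ, IsGauge (Set.Icc a b) δ ∧
    ∀ P Q : Finset (E × E × E),
      IsHKPartition (Set.Icc a b) P → IsFine δ P →
      IsHKPartition (Set.Icc a b) Q → IsFine δ Q →
      ∑ x ∈ P, ∑ y ∈ Q, ‖f x.1 - f y.1‖ * (volume (itemBox x ∩ itemBox y)).toReal < ε


/-- `P` is a `δ`-fine `𝓗𝓚`-partition of `[p,q]` along which every additive interval function
on `K` with values in `X` sums up to its value at `[p,q]`. -/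
structure IsSummingPartition (X : Type*) [NormedAddCommGroup X] (K : Set ℝ) (δ : ℝ → ℝ) (p q : ℝ)
    (P : Finset (ℝ × ℝ × ℝ)) : Prop where
  isHKPartition : IsHKPartition (Set.Icc p q) P
  isFine : IsFine δ P
  sum_eq : ∀ φ : ℝ × ℝ → X, IsAdditiveIntervalFun K φ → φ (p, q) = ∑ x ∈ P, φ x.2

theorem isSubinterval_Icc_iff {K : Set ℝ} {p q : ℝ} :
    IsSubinterval K p q ↔ Set.Icc p q ⊆ K ∧ p < q := by
  simp [IsSubinterval, interior_Icc]

theorem isSummingPartition_singleton {X : Type*} [NormedAddCommGroup X]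
    {K : Set ℝ} {δ : ℝ → ℝ} {p q t : ℝ} (hpq : p < q)
    (ht : t ∈ Set.Icc p q) (hδ : Set.Icc p q ⊆ Metric.ball t (δ t)) :
    IsSummingPartition X K δ p q {(t, p, q)} where
  isHKPartition := by
    refine ⟨⟨?_, ?_, ?_⟩, ?_⟩
    · simp only [Finset.mem_singleton, forall_eq]
      exact ⟨ht, isSubinterval_Icc_iff.2 ⟨subset_rfl, hpq⟩⟩
    · simp
    · simp [itemBox]
    · simpa [itemBox] using ht
  isFine := by simpa [IsFine, itemBox] using hδ
  sum_eq := by simp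

theorem IsMPartition.itemBox_subset {E : Type*} [MeasureSpace E] [PseudoMetricSpace E] [Preorder E]
    {K : Set E} {P : Finset (E × E × E)} (hP : IsMPartition K P) {x : E × E × E} (hx : x ∈ P) :
    itemBox x ⊆ K :=
  (hP.1 x hx).2.1

theorem IsSummingPartition.union {X : Type*} [NormedAddCommGroup X]
    {K : Set ℝ} {δ : ℝ → ℝ} {p m q : ℝ}
    {P Q : Finset (ℝ × ℝ × ℝ)} (hpm : p < m) (hmq : m < q) (hK : Set.Icc p q ⊆ K)
    (hP : IsSummingPartition X K δ p m P) (hQ : IsSummingPartition X K δ m q Q) :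
    IsSummingPartition X K δ p q (P ∪ Q) := by
  have hsP : Set.Icc p m ⊆ Set.Icc p q := Set.Icc_subset_Icc_right hmq.le
  have hsQ : Set.Icc m q ⊆ Set.Icc p q := Set.Icc_subset_Icc_left hpm.le
  have hint : interior (Set.Icc p m) ∩ interior (Set.Icc m q) = ∅ := by
    simp [interior_Icc, Set.Ioo_inter_Ioo, hpm.le, hmq.le]
  have hcross : ∀ x ∈ P, ∀ y ∈ Q, interior (itemBox x) ∩ interior (itemBox y) = ∅ :=
    fun x hx y hy => Set.subset_eq_empty (Set.inter_subset_inter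
      (interior_mono (hP.isHKPartition.1.itemBox_subset hx))
      (interior_mono (hQ.isHKPartition.1.itemBox_subset hy))) hint
  have hdisj : Disjoint P Q := by
    refine Finset.disjoint_left.2 fun x hx hy => ?_
    have h := hcross x hx x hy
    rw [Set.inter_self] at h
    exact ((hP.isHKPartition.1.1 x hx).2.2).ne_empty h
  refine ⟨⟨⟨?_, ?_, ?_⟩, ?_⟩, ?_, ?_⟩
  · intro x hx
    rcases Finset.mem_union.1 hx with hx | hx
    · obtain ⟨h1, h2, h3⟩ := hP.isHKPartition.1.1 x hx
      exact ⟨hsP h1, h2.trans hsP, h3⟩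
    · obtain ⟨h1, h2, h3⟩ := hQ.isHKPartition.1.1 x hx
      exact ⟨hsQ h1, h2.trans hsQ, h3⟩
  · intro x hx y hy hxy
    rcases Finset.mem_union.1 hx with hx | hx <;> rcases Finset.mem_union.1 hy with hy | hy
    · exact hP.isHKPartition.1.2.1 x hx y hy hxy
    · exact hcross x hx y hy
    · rw [Set.inter_comm]
      exact hcross y hy x hx
    · exact hQ.isHKPartition.1.2.1 x hx y hy hxy
  · rw [Finset.set_biUnion_union, hP.isHKPartition.1.2.2, hQ.isHKPartition.1.2.2,
      Set.Icc_union_Icc_eq_Icc hpm.le hmq.le]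
  · intro x hx
    exact (Finset.mem_union.1 hx).elim (hP.isHKPartition.2 x) (hQ.isHKPartition.2 x)
  · intro x hx
    exact (Finset.mem_union.1 hx).elim (hP.isFine x) (hQ.isFine x)
  · intro φ hφ
    rw [Finset.sum_union hdisj, ← hP.sum_eq φ hφ, ← hQ.sum_eq φ hφ]
    exact hφ p m m q p q (isSubinterval_Icc_iff.2 ⟨hsP.trans hK, hpm⟩)
      (isSubinterval_Icc_iff.2 ⟨hsQ.trans hK, hmq⟩)
      (isSubinterval_Icc_iff.2 ⟨hK, hpm.trans hmq⟩) hint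
      (Set.Icc_union_Icc_eq_Icc hpm.le hmq.le)

/-- Cousin's lemma, for summing partitions. -/
theorem exists_isSummingPartition (X : Type*) [NormedAddCommGroup X] {a b : ℝ} (hab : a < b)
    {δ : ℝ → ℝ} (hδ : IsGauge (Set.Icc a b) δ) :
    ∃ P, IsSummingPartition X (Set.Icc a b) δ a b P := by
  set S : Set ℝ := {x | x ∈ Set.Icc a b ∧
    (x = a ∨ ∃ P, IsSummingPartition X (Set.Icc a b) δ a x P)} with hS
  have haS : a ∈ S := ⟨Set.left_mem_Icc.2 hab.le, Or.inl rfl⟩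
  have hbdd : BddAbove S := ⟨b, fun x hx => hx.1.2⟩
  set c := sSup S with hc
  have hac : a ≤ c := le_csSup hbdd haS
  have hcb : c ≤ b := csSup_le ⟨a, haS⟩ fun x hx => hx.1.2
  have hδc : 0 < δ c := hδ c ⟨hac, hcb⟩
  obtain ⟨x, hxS, hx⟩ := exists_lt_of_lt_csSup ⟨a, haS⟩ (sub_lt_self c hδc)
  have hxc : x ≤ c := le_csSup hbdd hxS
  have key : ∀ y, c ≤ y → y < c + δ c → y ≤ b → y ∈ S := by
    intro y hcy hy hyb
    rcases (hxc.trans hcy).eq_or_lt with rfl | hxy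
    · exact hxS
    have hax : a ≤ x := hxS.1.1
    refine ⟨⟨hac.trans hcy, hyb⟩, Or.inr ?_⟩
    have hsingle : IsSummingPartition X (Set.Icc a b) δ x y {(c, x, y)} := by
      refine isSummingPartition_singleton hxy ⟨hxc, hcy⟩ fun z hz => ?_
      rw [Real.ball_eq_Ioo]
      exact ⟨hx.trans_le hz.1, hz.2.trans_lt hy⟩
    rcases hxS.2 with rfl | ⟨P, hP⟩
    · exact ⟨_, hsingle⟩
    rcases hax.eq_or_lt with rfl | hax
    · exact ⟨_, hsingle⟩
    exact ⟨_, hP.union hax hxy (Set.Icc_subset_Icc_right hyb) hsingle⟩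
  have hbS : b ∈ S := by
    by_cases h : b < c + δ c
    · exact key b hcb h le_rfl
    · have := le_csSup hbdd (key (c + δ c / 2) (by linarith) (by linarith) (by linarith))
      linarith
  exact hbS.2.resolve_left hab.ne'

theorem isSubinterval_prod {a₁ b₁ a₂ b₂ p₁ q₁ p₂ q₂ : ℝ}
    (h₁ : IsSubinterval (Set.Icc a₁ b₁) p₁ q₁) (h₂ : IsSubinterval (Set.Icc a₂ b₂) p₂ q₂) :
    IsSubinterval (Set.Icc ((a₁, a₂) : ℝ × ℝ) (b₁, b₂)) (p₁, p₂) (q₁, q₂) := by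
  simp only [IsSubinterval, ← Set.Icc_prod_Icc, interior_prod_eq]
  exact ⟨Set.prod_mono h₁.1 h₂.1, h₁.2.prod h₂.2⟩

theorem IsAdditiveIntervalFun.snd {X : Type*} [NormedAddCommGroup X]
    {a₁ b₁ a₂ b₂ p q : ℝ} {F : (ℝ × ℝ) × (ℝ × ℝ) → X}
    (hF : IsAdditiveIntervalFun (Set.Icc ((a₁, a₂) : ℝ × ℝ) (b₁, b₂)) F)
    (h : IsSubinterval (Set.Icc a₁ b₁) p q) :
    IsAdditiveIntervalFun (Set.Icc a₂ b₂) fun J : ℝ × ℝ => F ((p, J.1), (q, J.2)) := by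
  intro p' q' r s u w h₁ h₂ h₃ hint hun
  refine hF _ _ _ _ _ _ (isSubinterval_prod h h₁) (isSubinterval_prod h h₂)
    (isSubinterval_prod h h₃) ?_ ?_
  · simp only [← Set.Icc_prod_Icc, interior_prod_eq]
    rw [← Set.prod_inter, hint, Set.prod_empty]
  · simp only [← Set.Icc_prod_Icc]
    rw [← Set.prod_union, hun]

theorem IsAdditiveIntervalFun.fst {X : Type*} [NormedAddCommGroup X]
    {a₁ b₁ a₂ b₂ p q : ℝ} {F : (ℝ × ℝ) × (ℝ × ℝ) → X}
    (hF : IsAdditiveIntervalFun (Set.Icc ((a₁, a₂) : ℝ × ℝ) (b₁, b₂)) F)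
    (h : IsSubinterval (Set.Icc a₂ b₂) p q) :
    IsAdditiveIntervalFun (Set.Icc a₁ b₁) fun I : ℝ × ℝ => F ((I.1, p), (I.2, q)) := by
  intro p' q' r s u w h₁ h₂ h₃ hint hun
  refine hF _ _ _ _ _ _ (isSubinterval_prod h₁ h) (isSubinterval_prod h₂ h)
    (isSubinterval_prod h₃ h) ?_ ?_
  · simp only [← Set.Icc_prod_Icc, interior_prod_eq]
    rw [← Set.inter_prod, hint, Set.empty_prod]
  · simp only [← Set.Icc_prod_Icc]
    rw [← Set.union_prod, hun]

theorem IsMPartition.sum_volume_le {a b : ℝ} (hab : a ≤ b) {P : Finset (ℝ × ℝ × ℝ)}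
    (hP : IsMPartition (Set.Icc a b) P) :
    ∑ x ∈ P, (volume (itemBox x)).toReal ≤ b - a := by
  have hvol : ∀ x : ℝ × ℝ × ℝ, volume (interior (itemBox x)) = volume (itemBox x) := by
    intro x
    simp [itemBox, interior_Icc]
  have hfin : ∀ x ∈ P, volume (itemBox x) ≠ ⊤ := fun x _ => by simp [itemBox]
  rw [← ENNReal.toReal_sum hfin]
  refine ENNReal.toReal_le_of_le_ofReal (sub_nonneg.2 hab) ?_
  rw [← Real.volume_Icc, ← Finset.sum_congr rfl fun x _ => hvol x,
    ← measure_biUnion_finset (fun x hx y hy hxy =>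
        Set.disjoint_iff_inter_eq_empty.2 (hP.2.1 x hx y hy hxy))
      fun x _ => isOpen_interior.measurableSet]
  exact measure_mono (Set.iUnion₂_subset fun x hx =>
    interior_subset.trans (hP.itemBox_subset hx))

/-- The item of the plane with the two given items as its factors. -/
def prodItem (z : Σ _ : ℝ × ℝ × ℝ, ℝ × ℝ × ℝ) : (ℝ × ℝ) × (ℝ × ℝ) × (ℝ × ℝ) :=
  ((z.1.1, z.2.1), (z.1.2.1, z.2.2.1), (z.1.2.2, z.2.2.2))

theorem prodItem_injective : Function.Injective prodItem := by
  rintro ⟨⟨t, p, q⟩, ⟨s, r, u⟩⟩ ⟨⟨t', p', q'⟩, ⟨s', r', u'⟩⟩ h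
  simp only [prodItem, Prod.mk.injEq] at h
  obtain ⟨⟨rfl, rfl⟩, ⟨rfl, rfl⟩, rfl, rfl⟩ := h
  rfl

theorem itemBox_prodItem (z : Σ _ : ℝ × ℝ × ℝ, ℝ × ℝ × ℝ) :
    itemBox (prodItem z) = itemBox z.1 ×ˢ itemBox z.2 :=
  (Set.Icc_prod_Icc _ _ _ _).symm

theorem volume_itemBox_prodItem (z : Σ _ : ℝ × ℝ × ℝ, ℝ × ℝ × ℝ) :
    (volume (itemBox (prodItem z))).toReal =
      (volume (itemBox z.1)).toReal * (volume (itemBox z.2)).toReal := by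
  rw [itemBox_prodItem, Measure.volume_eq_prod, Measure.prod_prod, ENNReal.toReal_mul]

/-- Placing over each item of a partition of `[a₁,b₁]` a partition of `[a₂,b₂]` yields a partition
of the rectangle. -/
theorem IsHKPartition.image_prodItem {a₁ b₁ a₂ b₂ : ℝ} {P : Finset (ℝ × ℝ × ℝ)}
    {Q : ℝ × ℝ × ℝ → Finset (ℝ × ℝ × ℝ)} (hP : IsHKPartition (Set.Icc a₁ b₁) P)
    (hQ : ∀ x ∈ P, IsHKPartition (Set.Icc a₂ b₂) (Q x)) :
    IsHKPartition (Set.Icc ((a₁, a₂) : ℝ × ℝ) (b₁, b₂)) ((P.sigma Q).image prodItem) := by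
  refine ⟨⟨?_, ?_, ?_⟩, ?_⟩
  · simp only [Finset.forall_mem_image, Finset.mem_sigma]
    rintro z ⟨hx, hy⟩
    obtain ⟨h1, h2⟩ := hP.1.1 _ hx
    obtain ⟨h3, h4⟩ := (hQ _ hx).1.1 _ hy
    exact ⟨⟨⟨h1.1, h3.1⟩, h1.2, h3.2⟩, isSubinterval_prod h2 h4⟩
  · simp only [Finset.forall_mem_image, Finset.mem_sigma]
    rintro ⟨x, y⟩ ⟨hx, hy⟩ ⟨x', y'⟩ ⟨hx', hy'⟩ hne
    simp only at hx hy hx' hy'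
    rw [itemBox_prodItem, itemBox_prodItem, interior_prod_eq, interior_prod_eq, Set.prod_inter_prod]
    by_cases h : x = x'
    · subst h
      have hyy : y ≠ y' := by
        rintro rfl
        exact hne rfl
      rw [(hQ x hx).1.2.1 y hy y' hy' hyy, Set.prod_empty]
    · rw [hP.1.2.1 x hx x' hx' h, Set.empty_prod]
  · ext w
    rw [← Set.Icc_prod_Icc, Set.mem_prod, ← hP.1.2.2]
    simp only [Set.mem_iUnion, Finset.mem_image, Finset.mem_sigma, exists_prop]
    constructor
    · rintro ⟨_, ⟨z, ⟨hx, hy⟩, rfl⟩, hw⟩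
      rw [itemBox_prodItem] at hw
      exact ⟨⟨z.1, hx, hw.1⟩, (hQ _ hx).1.itemBox_subset hy hw.2⟩
    · rintro ⟨⟨x, hx, hw⟩, hw'⟩
      rw [← (hQ x hx).1.2.2] at hw'
      simp only [Set.mem_iUnion, exists_prop] at hw'
      obtain ⟨y, hy, hw'⟩ := hw'
      refine ⟨_, ⟨⟨x, y⟩, ⟨hx, hy⟩, rfl⟩, ?_⟩
      rw [itemBox_prodItem]
      exact ⟨hw, hw'⟩
  · simp only [Finset.forall_mem_image, Finset.mem_sigma]
    rintro z ⟨hx, hy⟩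
    rw [itemBox_prodItem]
    exact ⟨hP.2 _ hx, (hQ _ hx).2 _ hy⟩

theorem Finset.exists_pos_forall_le {ι : Type*} (s : Finset ι) {r : ι → ℝ}
    (h : ∀ i ∈ s, 0 < r i) : ∃ η > 0, ∀ i ∈ s, η ≤ r i := by
  rcases s.eq_empty_or_nonempty with rfl | hs
  · exact ⟨1, one_pos, by simp⟩
  · obtain ⟨i, hi, hmin⟩ := s.exists_min_image r hs
    exact ⟨r i, h i hi, hmin⟩

/-- A summing partition can be chosen fine for a prescribed gauge and with Riemann sum close to the
strong integral. -/
theorem HasStrongHKIntegral.exists_isSummingPartition {a b : ℝ} (hab : a < b) {h : ℝ → X} {u : X}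
    (hh : HasStrongHKIntegral a b h u) {δ : ℝ → ℝ} (hδ : IsGauge (Set.Icc a b) δ) {ε : ℝ}
    (hε : 0 < ε) :
    ∃ P, IsSummingPartition X (Set.Icc a b) δ a b P ∧
      ‖u - ∑ y ∈ P, (volume (itemBox y)).toReal • h y.1‖ < ε := by
  obtain ⟨H, hH, rfl, hHε⟩ := hh
  obtain ⟨γ, hγ, hγP⟩ := hHε ε hε
  obtain ⟨P, hP⟩ := _root_.exists_isSummingPartition X hab
    (δ := fun t => min (δ t) (γ t)) fun t ht => lt_min (hδ t ht) (hγ t ht)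
  refine ⟨P, ⟨hP.isHKPartition, fun x hx => (hP.isFine x hx).trans
    (Metric.ball_subset_ball (min_le_left _ _)), hP.sum_eq⟩, ?_⟩
  rw [norm_sub_rev, hP.sum_eq H hH, ← Finset.sum_sub_distrib]
  exact (norm_sum_le _ _).trans_lt (hγP P hP.isHKPartition fun x hx => (hP.isFine x hx).trans
    (Metric.ball_subset_ball (min_le_right _ _)))

/-- Lemma 2.2(i) for the Henstock–Kurzweil integral:
if `f` is strongly integrable on `[a,b]` with integral `v` and all sections are strongly
integrable, then the iterated integral of the sections is strongly integrable with integral `v`. -/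
theorem fubini_strong_hk_fst {X : Type*} [NormedAddCommGroup X] [NormedSpace ℝ X] [CompleteSpace X] (a₁ b₁ a₂ b₂ : ℝ) (hab₁ : a₁ < b₁) (hab₂ : a₂ < b₂)
    (f : ℝ × ℝ → X) (v : X) (g : ℝ → X)
    (hf : HasStrongHKIntegral ((a₁, a₂) : ℝ × ℝ) (b₁, b₂) f v)
    (hg : ∀ t₁ ∈ Set.Icc a₁ b₁, HasStrongHKIntegral a₂ b₂ (fun s₂ => f (t₁, s₂)) (g t₁))
    (hsec : ∀ t₂ ∈ Set.Icc a₂ b₂, ∃ u : X, HasStrongHKIntegral a₁ b₁ (fun s₁ => f (s₁, t₂)) u) :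
    HasStrongHKIntegral a₁ b₁ g v := by
  classical
  obtain ⟨F, hF, hFv, hFε⟩ := hf
  have hK₂ : IsSubinterval (Set.Icc a₂ b₂) a₂ b₂ := isSubinterval_Icc_iff.2 ⟨subset_rfl, hab₂⟩
  refine ⟨fun I => F ((I.1, a₂), (I.2, b₂)), hF.fst hK₂, hFv, fun ε hε => ?_⟩
  obtain ⟨δ, hδ, hδP⟩ := hFε (ε / 2) (half_pos hε)
  have hL : 0 < b₁ - a₁ := sub_pos.2 hab₁
  have hε' : 0 < ε / (2 * (b₁ - a₁)) := by positivity
  have hfiber : ∀ t : ℝ, ∃ (η : ℝ) (Q : Finset (ℝ × ℝ × ℝ)), t ∈ Set.Icc a₁ b₁ →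
      0 < η ∧ (∀ y ∈ Q, η ≤ δ (t, y.1)) ∧
      IsSummingPartition X (Set.Icc a₂ b₂) (fun s => δ (t, s)) a₂ b₂ Q ∧
      ‖g t - ∑ y ∈ Q, (volume (itemBox y)).toReal • f (t, y.1)‖ < ε / (2 * (b₁ - a₁)) := by
    intro t
    by_cases ht : t ∈ Set.Icc a₁ b₁
    · have hδt : ∀ s ∈ Set.Icc a₂ b₂, 0 < δ (t, s) :=
        fun s hs => hδ _ ⟨⟨ht.1, hs.1⟩, ht.2, hs.2⟩
      obtain ⟨Q, hQ, hQε⟩ := (hg t ht).exists_isSummingPartition hab₂ hδt hε'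
      obtain ⟨η, hη, hηQ⟩ := Q.exists_pos_forall_le (r := fun y => δ (t, y.1))
        fun y hy => hδt _ (hQ.isHKPartition.1.1 y hy).1
      exact ⟨η, Q, fun _ => ⟨hη, hηQ, hQ, hQε⟩⟩
    · exact ⟨0, ∅, fun h => absurd h ht⟩
  choose η Q hηQ using hfiber
  refine ⟨η, fun t ht => (hηQ t ht).1, fun P hP hPη => ?_⟩
  have htag : ∀ x ∈ P, x.1 ∈ Set.Icc a₁ b₁ := fun x hx => (hP.1.1 x hx).1
  have hR := hP.image_prodItem (Q := fun x => Q x.1)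
    fun x hx => (hηQ x.1 (htag x hx)).2.2.1.isHKPartition
  have hRfine : IsFine δ ((P.sigma fun x => Q x.1).image prodItem) := by
    simp only [IsFine, Finset.forall_mem_image, Finset.mem_sigma]
    rintro z ⟨hx, hy⟩
    obtain ⟨-, hη, hQ, -⟩ := hηQ z.1.1 (htag _ hx)
    rw [itemBox_prodItem]
    change _ ⊆ Metric.ball (z.1.1, z.2.1) (δ (z.1.1, z.2.1))
    rw [← ball_prod_same]
    exact Set.prod_mono ((hPη _ hx).trans (Metric.ball_subset_ball (hη _ hy))) (hQ.isFine _ hy)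
  have hsum := hδP _ hR hRfine
  rw [Finset.sum_image prodItem_injective.injOn, Finset.sum_sigma] at hsum
  have hitem : ∀ x ∈ P, ‖(volume (itemBox x)).toReal • g x.1 - F ((x.2.1, a₂), (x.2.2, b₂))‖ ≤
      (volume (itemBox x)).toReal * (ε / (2 * (b₁ - a₁))) +
      ∑ y ∈ Q x.1, ‖(volume (itemBox (prodItem ⟨x, y⟩))).toReal • f (prodItem ⟨x, y⟩).1 -
        F ((prodItem ⟨x, y⟩).2.1, (prodItem ⟨x, y⟩).2.2)‖ := by
    intro x hx
    obtain ⟨-, -, hQ, hQε⟩ := hηQ x.1 (htag x hx)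
    have hadd := hQ.sum_eq _ (hF.snd (hP.1.1 x hx).2)
    have hsplit : (volume (itemBox x)).toReal • g x.1 - F ((x.2.1, a₂), (x.2.2, b₂)) =
        (volume (itemBox x)).toReal •
          (g x.1 - ∑ y ∈ Q x.1, (volume (itemBox y)).toReal • f (x.1, y.1)) +
        ∑ y ∈ Q x.1, ((volume (itemBox (prodItem ⟨x, y⟩))).toReal • f (prodItem ⟨x, y⟩).1 -
          F ((prodItem ⟨x, y⟩).2.1, (prodItem ⟨x, y⟩).2.2)) := by
      simp only [volume_itemBox_prodItem, mul_smul]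
      rw [Finset.sum_sub_distrib, ← Finset.smul_sum, smul_sub]
      simp only [prodItem] at hadd ⊢
      rw [hadd]
      abel
    rw [hsplit]
    refine (norm_add_le _ _).trans (add_le_add ?_ (norm_sum_le _ _))
    rw [norm_smul, Real.norm_of_nonneg ENNReal.toReal_nonneg]
    exact mul_le_mul_of_nonneg_left hQε.le ENNReal.toReal_nonneg
  have hvol : (∑ x ∈ P, (volume (itemBox x)).toReal) * (ε / (2 * (b₁ - a₁))) ≤ ε / 2 := by
    calc (∑ x ∈ P, (volume (itemBox x)).toReal) * (ε / (2 * (b₁ - a₁)))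
        ≤ (b₁ - a₁) * (ε / (2 * (b₁ - a₁))) :=
          mul_le_mul_of_nonneg_right (hP.1.sum_volume_le hab₁.le) hε'.le
      _ = ε / 2 := by field_simp
  have htotal := Finset.sum_le_sum hitem
  rw [Finset.sum_add_distrib, ← Finset.sum_mul] at htotal
  linarith
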